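/- Let E ⊆ ℕA be the exponent set of a monomial ideal. Then there are only finitely many overlap classes of standard pairs of E; that is, the quotient of the set of standard pairs of E by the overlap equivalence relation is finite. -/

import Mathlib

open scoped BigOperators

namespace StdPairsPaper

/-- The coercion of a lattice point to a real vector. -/
def toR {d : ℕ} (v : Fin d → ℤ) : Fin d → ℝ := fun i => (v i : ℝ)

/-- The cone of nonnegative real combinations of (the real images of) elements of `S`. -/
def cone {d : ℕ} (S : Set (Fin d → ℤ)) : Set (Fin d → ℝ) :=
  {x | ∃ (t : Finset (Fin d → ℤ)) (c : (Fin d → ℤ) → ℝ),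
    (t : Set (Fin d → ℤ)) ⊆ S ∧ (∀ v, 0 ≤ c v) ∧ x = ∑ v ∈ t, c v • toR v}

/-- `ℕS`, the submonoid of `ℤ^d` generated by `S`. -/
def NSemi {d : ℕ} (S : Set (Fin d → ℤ)) : AddSubmonoid (Fin d → ℤ) :=
  AddSubmonoid.closure S

/-- `ℤS`, the subgroup of `ℤ^d` generated by `S`. -/
def ZGrp {d : ℕ} (S : Set (Fin d → ℤ)) : AddSubgroup (Fin d → ℤ) :=
  AddSubgroup.closure S

/-- `ℝS`, the real linear span of `S`. -/
def RSpan {d : ℕ} (S : Set (Fin d → ℤ)) : Submodule ℝ (Fin d → ℝ) :=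
  Submodule.span ℝ (toR '' S)

/-- `A` is a configuration: a finite set of nonzero lattice points whose `ℤ`-span is `ℤ^d`
and whose nonnegative real cone is strongly convex (contains no line, i.e. is pointed). -/
structure IsConfig {d : ℕ} (A : Set (Fin d → ℤ)) : Prop where
  (finite : A.Finite)
  (nonzero : (0 : Fin d → ℤ) ∉ A)
  (spans : ZGrp A = ⊤)
  (pointed : ∀ x ∈ cone A, -x ∈ cone A → x = 0)

/-- `F` is a face of the configuration `A`: `F ⊆ A`, the cone over `F` is an extreme
subset (face) of the cone over `A`, and `ℝ_{≥0}F ∩ A = F`. -/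
def IsFace {d : ℕ} (A F : Set (Fin d → ℤ)) : Prop :=
  F ⊆ A ∧ IsExtreme ℝ (cone A) (cone F) ∧ cone F ∩ (toR '' A) = toR '' F

/-- The set `a + ℕF`. -/
def cell {d : ℕ} (a : Fin d → ℤ) (F : Set (Fin d → ℤ)) : Set (Fin d → ℤ) :=
  {x | ∃ f ∈ NSemi F, x = a + f}

/-- Two pairs `(a,F)` and `(b,F)` belonging to the same face `F` overlap: `a - b ∈ ℤF`. -/
def Overlap {d : ℕ} (F : Set (Fin d → ℤ)) (a b : Fin d → ℤ) : Prop :=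
  a - b ∈ ZGrp F

/-- The pair `(a,F)` divides the pair `(b,G)`:
there is `c ∈ ℕA` with `a + c + ℕF ⊆ b + ℕG`. -/
def PairDvd {d : ℕ} (A : Set (Fin d → ℤ)) (a : Fin d → ℤ) (F : Set (Fin d → ℤ))
    (b : Fin d → ℤ) (G : Set (Fin d → ℤ)) : Prop :=
  ∃ c ∈ NSemi A, cell (a + c) F ⊆ cell b G

/-- `E` is the exponent set of a monomial ideal of `ℕA`: `E ⊆ ℕA` and `E + ℕA ⊆ E`. -/
def IsExpSet {d : ℕ} (A E : Set (Fin d → ℤ)) : Prop :=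
  E ⊆ (NSemi A : Set (Fin d → ℤ)) ∧ ∀ e ∈ E, ∀ c ∈ NSemi A, e + c ∈ E

/-- The standard monomials of `E`: `ℕA ∖ E`. -/
def stdSet {d : ℕ} (A E : Set (Fin d → ℤ)) : Set (Fin d → ℤ) :=
  (NSemi A : Set (Fin d → ℤ)) \ E

/-- `(a,F)` is a proper pair of `E`: a pair of `A` with `a + ℕF ⊆ std(E)`. -/
def ProperPair {d : ℕ} (A E : Set (Fin d → ℤ)) (a : Fin d → ℤ)
    (F : Set (Fin d → ℤ)) : Prop :=
  a ∈ NSemi A ∧ IsFace A F ∧ cell a F ⊆ stdSet A E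

/-- `(a,F)` is a standard pair of `E`: a proper pair of `E` maximal with respect to
the partial order `(a,F) ≼ (b,G) ↔ a + ℕF ⊆ b + ℕG`. -/
def StdPair {d : ℕ} (A E : Set (Fin d → ℤ)) (a : Fin d → ℤ)
    (F : Set (Fin d → ℤ)) : Prop :=
  ProperPair A E a F ∧
    ∀ b G, ProperPair A E b G → cell a F ⊆ cell b G → cell b G ⊆ cell a F

/-- The overlap class of the standard pair `(a,F)` of `E` is maximal with respect to
divisibility among overlap classes of standard pairs of `E`. -/
def MaxClass {d : ℕ} (A E : Set (Fin d → ℤ)) (a : Fin d → ℤ)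
    (F : Set (Fin d → ℤ)) : Prop :=
  ∀ b G, StdPair A E b G → PairDvd A a F b G → PairDvd A b G a F

noncomputable section

/-- The affine semigroup ring `k[ℕA]`. -/
abbrev SGRing {d : ℕ} (k : Type*) [Field k] (A : Set (Fin d → ℤ)) :=
  AddMonoidAlgebra k (NSemi A)

/-- The monomial `t^a` of `k[ℕA]`. -/
def mono {d : ℕ} (k : Type*) [Field k] (A : Set (Fin d → ℤ)) (a : (NSemi A)) :
    SGRing k A :=
  AddMonoidAlgebra.single a 1

/-- `I` is a monomial ideal of `k[ℕA]`: an ideal generated by monomials. -/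
def IsMonomialIdeal {d : ℕ} (k : Type*) [Field k] (A : Set (Fin d → ℤ))
    (I : Ideal (SGRing k A)) : Prop :=
  ∃ S : Set (NSemi A), I = Ideal.span ((fun a => mono k A a) '' S)

/-- The exponent set `E(I) = {a ∈ ℕA : t^a ∈ I}` of an ideal of `k[ℕA]`,
as a subset of `ℤ^d`. -/
def expSet {d : ℕ} (k : Type*) [Field k] (A : Set (Fin d → ℤ))
    (I : Ideal (SGRing k A)) : Set (Fin d → ℤ) :=
  {x | ∃ h : x ∈ NSemi A, mono k A ⟨x, h⟩ ∈ I}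

/-- The monomial prime ideal `p_F = ⟨t^a : a ∈ ℕA ∖ ℕF⟩` of `k[ℕA]`. -/
def primeF {d : ℕ} (k : Type*) [Field k] (A F : Set (Fin d → ℤ)) :
    Ideal (SGRing k A) :=
  Ideal.span {x | ∃ a : (NSemi A), (a : Fin d → ℤ) ∉ NSemi F ∧ x = mono k A a}

end


theorem toR_injective {d : ℕ} : Function.Injective (toR (d := d)) := fun v w h =>
  funext fun i => by simpa [toR] using congrFun h i

theorem toR_add {d : ℕ} (v w : Fin d → ℤ) : toR (v + w) = toR v + toR w := by
  ext j
  simp [toR]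

/-- A real linear relation among lattice vectors can be replaced by an integral one that keeps the
nonnegative coefficients nonnegative and a chosen positive coefficient positive. -/
theorem exists_int_relation {d : ℕ} {ι : Type*} [Fintype ι] (u : ι → Fin d → ℤ) (c : ι → ℝ)
    (h : ∑ i, c i • toR (u i) = 0) (i₀ : ι) (h₀ : 0 < c i₀) :
    ∃ n : ι → ℤ, (∀ i, 0 ≤ c i → 0 ≤ n i) ∧ 0 < n i₀ ∧ ∑ i, n i • u i = 0 := by
  obtain ⟨k, hk⟩ := exists_nat_ge (c i₀)⁻¹
  have hk1 : 1 ≤ k * c i₀ := by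
    rw [inv_le_iff_one_le_mul₀ h₀] at hk
    exact hk
  let e : ℕ → Fin d → ℤ := fun m => ∑ i, ⌊(m : ℝ) * (k * c i)⌋ • u i
  let B : Fin d → ℤ := fun j => ∑ i, |u i j|
  have he : Set.MapsTo e Set.univ (Set.Icc (-B) B) := by
    intro m _
    have key : ∀ j, |e m j| ≤ B j := by
      intro j
      have hj : ∑ i, c i * (u i j : ℝ) = 0 := by
        simpa [Finset.sum_apply, toR] using congrFun h j
      have h1 : (e m j : ℝ) = -∑ i, Int.fract ((m : ℝ) * (k * c i)) * (u i j : ℝ) := by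
        have h2 : (e m j : ℝ) = ∑ i, ((m : ℝ) * (k * c i) - Int.fract ((m : ℝ) * (k * c i))) *
            (u i j : ℝ) := by
          simp [e, Finset.sum_apply, Int.self_sub_fract]
        have h3 : ∑ i, (m : ℝ) * (k * c i) * (u i j : ℝ) = 0 := by
          calc _ = (m : ℝ) * k * ∑ i, c i * (u i j : ℝ) := by
                rw [Finset.mul_sum]
                exact Finset.sum_congr rfl fun i _ => by ring
            _ = 0 := by rw [hj, mul_zero]
        rw [h2]
        simp_rw [sub_mul]
        rw [Finset.sum_sub_distrib, h3, zero_sub]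
      have h4 : |(e m j : ℝ)| ≤ ((B j : ℤ) : ℝ) := by
        rw [h1, abs_neg]
        refine (Finset.abs_sum_le_sum_abs _ _).trans ?_
        simp only [B, Int.cast_sum, Int.cast_abs]
        refine Finset.sum_le_sum fun i _ => ?_
        rw [abs_mul, abs_of_nonneg (Int.fract_nonneg _)]
        exact mul_le_of_le_one_left (abs_nonneg _) (Int.fract_lt_one _).le
      exact_mod_cast h4
    exact ⟨fun j => (abs_le.mp (key j)).1, fun j => (abs_le.mp (key j)).2⟩
  obtain ⟨m, -, m', -, hlt, heq⟩ :=
    Set.infinite_univ.exists_lt_map_eq_of_mapsTo he (Set.finite_Icc _ _)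
  have hlt' : (m : ℝ) + 1 ≤ m' := by exact_mod_cast hlt
  refine ⟨fun i => ⌊(m' : ℝ) * (k * c i)⌋ - ⌊(m : ℝ) * (k * c i)⌋, fun i hi => ?_, ?_, ?_⟩
  · refine sub_nonneg.mpr (Int.floor_le_floor ?_)
    have : 0 ≤ (k : ℝ) * c i := by positivity
    nlinarith
  · have : ⌊(m : ℝ) * (k * c i₀)⌋ + 1 ≤ ⌊(m' : ℝ) * (k * c i₀)⌋ := by
      rw [← Int.floor_add_one]
      refine Int.floor_le_floor ?_
      nlinarith
    exact sub_pos.mpr (by omega)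
  · simp only [sub_smul, Finset.sum_sub_distrib]
    exact sub_eq_zero.mpr heq.symm

theorem cone_eq_hull {d : ℕ} (S : Set (Fin d → ℤ)) :
    cone S = (PointedCone.hull ℝ (toR '' S) : Set (Fin d → ℝ)) := by
  ext x
  constructor
  · rintro ⟨t, c, ht, hc, rfl⟩
    refine sum_mem fun v hv => ?_
    exact Submodule.smul_mem _ (⟨c v, hc v⟩ : {r : ℝ // 0 ≤ r})
      (Submodule.subset_span ⟨v, ht hv, rfl⟩)
  · intro hx
    obtain ⟨l, hl, rfl⟩ := (Finsupp.mem_span_image_iff_linearCombination _).mp hx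
    exact ⟨l.support, fun v => l v, hl, fun v => (l v).2, rfl⟩

theorem toR_mem_cone {d : ℕ} {S : Set (Fin d → ℤ)} {v : Fin d → ℤ} (hv : v ∈ S) :
    toR v ∈ cone S := by
  rw [cone_eq_hull]
  exact Submodule.subset_span ⟨v, hv, rfl⟩

theorem add_mem_cone {d : ℕ} {S : Set (Fin d → ℤ)} {x y : Fin d → ℝ} (hx : x ∈ cone S)
    (hy : y ∈ cone S) : x + y ∈ cone S := by
  rw [cone_eq_hull] at *
  exact add_mem hx hy

theorem smul_mem_cone {d : ℕ} {S : Set (Fin d → ℤ)} {x : Fin d → ℝ} {r : ℝ} (hr : 0 ≤ r)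
    (hx : x ∈ cone S) : r • x ∈ cone S := by
  rw [cone_eq_hull] at *
  exact Submodule.smul_mem _ (⟨r, hr⟩ : {r : ℝ // 0 ≤ r}) hx

theorem sum_mem_cone {d : ℕ} {S : Set (Fin d → ℤ)} {ι : Type*} {t : Finset ι}
    {x : ι → Fin d → ℝ} (hx : ∀ i ∈ t, x i ∈ cone S) : ∑ i ∈ t, x i ∈ cone S := by
  simp_rw [cone_eq_hull] at *
  exact sum_mem hx

theorem cone_mono {d : ℕ} {S T : Set (Fin d → ℤ)} (h : S ⊆ T) : cone S ⊆ cone T := by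
  rintro x ⟨t, c, ht, hc, rfl⟩
  exact ⟨t, c, ht.trans h, hc, rfl⟩

/-- Integral points of the monoid lie in the cone. -/
theorem toR_mem_cone_of_mem_NSemi {d : ℕ} {S : Set (Fin d → ℤ)} {x : Fin d → ℤ}
    (hx : x ∈ NSemi S) : toR x ∈ cone S := by
  induction hx using AddSubmonoid.closure_induction with
  | mem x hx => exact toR_mem_cone hx
  | zero => exact ⟨∅, 0, by simp, by simp, by ext; simp [toR]⟩
  | add x y _ _ hx hy => rw [toR_add]; exact add_mem_cone hx hy

/-- An element of `cone S` is a combination over any finite `A ⊇ S`, supported on `S`. -/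
theorem exists_coeff_of_mem_cone {d : ℕ} {S A : Set (Fin d → ℤ)} [Fintype A] (hS : S ⊆ A)
    {x : Fin d → ℝ} (hx : x ∈ cone S) :
    ∃ c : A → ℝ, (∀ v, 0 ≤ c v) ∧ (∀ v : A, (v : Fin d → ℤ) ∉ S → c v = 0) ∧
      x = ∑ v, c v • toR (v : Fin d → ℤ) := by
  classical
  rw [cone_eq_hull] at hx
  induction hx using Submodule.span_induction with
  | mem x hx =>
    obtain ⟨v, hv, rfl⟩ := hx
    refine ⟨Pi.single ⟨v, hS hv⟩ 1, fun w => ?_, fun w hw => ?_, ?_⟩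
    · by_cases h : w = ⟨v, hS hv⟩ <;> simp [h]
    · exact Pi.single_eq_of_ne (fun h => hw (by rw [h]; exact hv)) _
    · simp [Pi.single_apply, ite_smul]
  | zero => exact ⟨0, by simp, by simp, by simp⟩
  | add x y _ _ hx hy =>
    obtain ⟨c, hc, hc', rfl⟩ := hx
    obtain ⟨c₂, hc₂, hc₂', rfl⟩ := hy
    exact ⟨c + c₂, fun v => add_nonneg (hc v) (hc₂ v), fun v hv => by simp [hc' v hv, hc₂' v hv],
      by simp [add_smul, Finset.sum_add_distrib]⟩
  | smul r x _ hx =>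
    obtain ⟨c, hc, hc', rfl⟩ := hx
    refine ⟨(r : ℝ) • c, fun v => mul_nonneg r.2 (hc v), fun v hv => by simp [hc' v hv], ?_⟩
    simp only [Pi.smul_apply, smul_assoc, ← Finset.smul_sum]
    rfl

/-- An element of `ℕS` is a combination over any finite `A ⊇ S`, supported on `S`. -/
theorem exists_coeff_of_mem_NSemi {d : ℕ} {S A : Set (Fin d → ℤ)} [Fintype A] (hS : S ⊆ A)
    {x : Fin d → ℤ} (hx : x ∈ NSemi S) :
    ∃ n : A → ℕ, (∀ v : A, (v : Fin d → ℤ) ∉ S → n v = 0) ∧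
      x = ∑ v, n v • (v : Fin d → ℤ) := by
  classical
  induction hx using AddSubmonoid.closure_induction with
  | mem v hv =>
    refine ⟨Pi.single ⟨v, hS hv⟩ 1, fun w hw => ?_, ?_⟩
    · exact Pi.single_eq_of_ne (fun h => hw (by rw [h]; exact hv)) _
    · simp [Pi.single_apply, ite_smul]
  | zero => exact ⟨0, by simp, by simp⟩
  | add x y _ _ hx hy =>
    obtain ⟨c, hc, rfl⟩ := hx
    obtain ⟨c₂, hc₂, rfl⟩ := hy
    exact ⟨c + c₂, fun v hv => by simp [hc v hv, hc₂ v hv],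
      by simp [add_smul, Finset.sum_add_distrib]⟩

theorem sum_mem_NSemi {d : ℕ} {S A : Set (Fin d → ℤ)} [Fintype A] (n : A → ℕ)
    (hn : ∀ v : A, (v : Fin d → ℤ) ∉ S → n v = 0) :
    ∑ v, n v • (v : Fin d → ℤ) ∈ NSemi S := by
  refine sum_mem fun v _ => ?_
  by_cases hv : (v : Fin d → ℤ) ∈ S
  · exact AddSubmonoid.nsmul_mem _ (AddSubmonoid.subset_closure hv) _
  · simp [hn v hv]

/-- The elements of `A` that divide an element of `ℕS`: the smallest face of `A` containing `S`. -/
def faceHull {d : ℕ} (A S : Set (Fin d → ℤ)) : Set (Fin d → ℤ) :=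
  {v ∈ A | ∃ y ∈ NSemi A, v + y ∈ NSemi S}

theorem subset_faceHull {d : ℕ} {A S : Set (Fin d → ℤ)} (hS : S ⊆ A) : S ⊆ faceHull A S :=
  fun v hv => ⟨hS hv, 0, zero_mem _, by rw [add_zero]; exact AddSubmonoid.subset_closure hv⟩

theorem exists_add_mem_NSemi_of_mem_NSemi_faceHull {d : ℕ} {A S : Set (Fin d → ℤ)}
    {x : Fin d → ℤ} (hx : x ∈ NSemi (faceHull A S)) : ∃ y ∈ NSemi A, x + y ∈ NSemi S := by
  induction hx using AddSubmonoid.closure_induction with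
  | mem v hv => exact hv.2
  | zero => exact ⟨0, zero_mem _, by simp⟩
  | add x x' _ _ hx hx' =>
    obtain ⟨y, hy, h⟩ := hx
    obtain ⟨y', hy', h'⟩ := hx'
    exact ⟨y + y', add_mem hy hy', by rw [add_add_add_comm]; exact add_mem h h'⟩

theorem exists_add_mem_cone_of_mem_cone_faceHull {d : ℕ} {A S : Set (Fin d → ℤ)}
    {z : Fin d → ℝ} (hz : z ∈ cone (faceHull A S)) : ∃ w ∈ cone A, z + w ∈ cone S := by
  obtain ⟨t, c, ht, hc, rfl⟩ := hz
  choose! y hy hys using fun v (hv : v ∈ faceHull A S) => hv.2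
  refine ⟨∑ v ∈ t, c v • toR (y v), sum_mem_cone fun v hv =>
    smul_mem_cone (hc v) (toR_mem_cone_of_mem_NSemi (hy v (ht hv))), ?_⟩
  rw [← Finset.sum_add_distrib]
  refine sum_mem_cone fun v hv => ?_
  rw [← smul_add, ← toR_add]
  exact smul_mem_cone (hc v) (toR_mem_cone_of_mem_NSemi (hys v (ht hv)))

/-- If a positive multiple of `v ∈ A` is a summand, within the cone over `A`, of an element of the
cone over the face hull of `S`, then `v` lies in the face hull of `S`. -/
theorem mem_faceHull_of_smul_add_mem_cone {d : ℕ} {A S : Set (Fin d → ℤ)} (hA : A.Finite)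
    (hS : S ⊆ A) {v : Fin d → ℤ} (hv : v ∈ A) {r : ℝ} (hr : 0 < r) {w : Fin d → ℝ}
    (hw : w ∈ cone A) (h : r • toR v + w ∈ cone (faceHull A S)) : v ∈ faceHull A S := by
  classical
  by_cases hvS : v ∈ S
  · exact subset_faceHull hS hvS
  have := hA.fintype
  obtain ⟨w', hw', hs⟩ := exists_add_mem_cone_of_mem_cone_faceHull h
  rw [add_assoc] at hs
  obtain ⟨c, hc, -, hcw⟩ := exists_coeff_of_mem_cone subset_rfl (add_mem_cone hw hw')
  obtain ⟨b, -, hbS, hbs⟩ := exists_coeff_of_mem_cone hS hs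
  let v₀ : A := ⟨v, hv⟩
  obtain ⟨n, hn, hn₀, hsum⟩ := exists_int_relation (fun u : A => (u : Fin d → ℤ))
    (fun u => (Pi.single v₀ r : A → ℝ) u + c u - b u) (by
      rw [hcw] at hbs
      simp only [sub_smul, add_smul, Finset.sum_sub_distrib, Finset.sum_add_distrib, ← hbs]
      simp [Pi.single_apply, ite_smul, v₀]) v₀ (by
      have := hc v₀
      simp only [Pi.single_eq_same, hbS v₀ hvS]
      linarith)
  have hnS : ∀ u : A, (u : Fin d → ℤ) ∉ S → 0 ≤ n u := fun u hu => hn u (by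
    have := hc u
    rw [hbS u hu, sub_zero]
    refine add_nonneg ?_ (hc u)
    by_cases huv : u = v₀ <;> simp [huv, hr.le])
  refine ⟨hv, ∑ u : A, ((n u).toNat - (Pi.single v₀ 1 : A → ℕ) u : ℕ) • (u : Fin d → ℤ),
    sum_mem_NSemi _ fun u hu => absurd u.2 hu, ?_⟩
  have hpos : v + ∑ u : A, ((n u).toNat - (Pi.single v₀ 1 : A → ℕ) u : ℕ) • (u : Fin d → ℤ) =
      ∑ u : A, (-n u).toNat • (u : Fin d → ℤ) := by
    have hv' : v = ∑ u : A, ((Pi.single v₀ 1 : A → ℕ) u : ℕ) • (u : Fin d → ℤ) := by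
      simp [Pi.single_apply, ite_smul, v₀]
    nth_rewrite 1 [hv']
    rw [← Finset.sum_add_distrib, ← sub_eq_zero, ← Finset.sum_sub_distrib, ← hsum]
    refine Finset.sum_congr rfl fun u _ => ?_
    rw [← add_smul, ← natCast_zsmul, ← natCast_zsmul, ← sub_smul]
    congr 1
    by_cases huv : u = v₀
    · subst huv; simp only [Pi.single_eq_same]; omega
    · simp only [Pi.single_eq_of_ne huv]; omega
  rw [hpos]
  exact sum_mem_NSemi _ fun u hu => by have := hnS u hu; omega

theorem isFace_faceHull {d : ℕ} {A S : Set (Fin d → ℤ)} (hA : A.Finite) (hS : S ⊆ A) :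
    IsFace A (faceHull A S) := by
  have hsub : faceHull A S ⊆ A := fun v hv => hv.1
  refine ⟨hsub, ⟨cone_mono hsub, ?_⟩, ?_⟩
  · rintro x ⟨t, c, ht, hc, rfl⟩ y hy z hz ⟨α, β, hα, hβ, -, rfl⟩
    classical
    refine sum_mem_cone fun v hv => ?_
    rcases (hc v).eq_or_lt with h0 | h0
    · rw [← h0, zero_smul]
      exact ⟨∅, 0, by simp, by simp, by simp⟩
    · refine smul_mem_cone (hc v) (toR_mem_cone ?_)
      refine mem_faceHull_of_smul_add_mem_cone hA hS (ht hv) (mul_pos hα h0)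
        (w := α • ∑ u ∈ t.erase v, c u • toR u + β • y) (add_mem_cone (smul_mem_cone hα.le
          (sum_mem_cone fun u hu => smul_mem_cone (hc u)
            (toR_mem_cone (ht (Finset.mem_of_mem_erase hu))))) (smul_mem_cone hβ.le hy)) ?_
      rwa [← add_assoc, mul_smul, ← smul_add, Finset.add_sum_erase t (fun u => c u • toR u) hv]
  · ext x
    constructor
    · rintro ⟨hx, v, hv, rfl⟩
      refine ⟨v, mem_faceHull_of_smul_add_mem_cone hA hS hv one_pos
        (w := 0) ⟨∅, 0, by simp, by simp, by simp⟩ ?_, rfl⟩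
      simpa using hx
    · rintro ⟨v, hv, rfl⟩
      exact ⟨toR_mem_cone hv, v, hv.1, rfl⟩

/-- The face of a standard pair `(a, F)` cannot be enlarged, even to a non-face `S`. -/
theorem StdPair.subset_of_cell_subset {d : ℕ} {A E F S : Set (Fin d → ℤ)} {a : Fin d → ℤ}
    (hA : A.Finite) (hE : IsExpSet A E) (h : StdPair A E a F) (hFS : F ⊆ S) (hS : S ⊆ A)
    (hcell : cell a S ⊆ stdSet A E) : S ⊆ F := by
  obtain ⟨⟨ha, hF, -⟩, hmax⟩ := h
  have hG := isFace_faceHull hA hS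
  have hproper : ProperPair A E a (faceHull A S) := by
    refine ⟨ha, hG, ?_⟩
    rintro _ ⟨g, hg, rfl⟩
    refine ⟨add_mem ha (AddSubmonoid.closure_mono hG.1 hg), fun hgE => ?_⟩
    obtain ⟨y, hy, hgy⟩ := exists_add_mem_NSemi_of_mem_NSemi_faceHull hg
    refine (hcell ⟨g + y, hgy, rfl⟩).2 ?_
    rw [← add_assoc]
    exact hE.2 _ hgE y hy
  have hle : cell a F ⊆ cell a (faceHull A S) := by
    rintro _ ⟨f, hf, rfl⟩
    exact ⟨f, AddSubmonoid.closure_mono (hFS.trans (subset_faceHull hS)) hf, rfl⟩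
  intro v hv
  obtain ⟨f, hf, hvf⟩ := hmax a _ hproper hle
    ⟨v, AddSubmonoid.subset_closure (subset_faceHull hS hv), rfl⟩
  obtain rfl : v = f := add_left_cancel hvf
  have hv' : toR v ∈ toR '' F := by
    rw [← hF.2.2]
    exact ⟨toR_mem_cone_of_mem_NSemi hf, v, hS hv, rfl⟩
  exact (toR_injective.mem_set_image).mp hv'

/-- In any sequence of standard pairs with common face `F`, two pairs overlap. -/
theorem exists_overlap_of_forall_stdPair {d : ℕ} {A E F : Set (Fin d → ℤ)} (hA : A.Finite)
    (hE : IsExpSet A E) (a : ℕ → Fin d → ℤ) (h : ∀ i, StdPair A E (a i) F) :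
    ∃ i j, i ≠ j ∧ Overlap F (a i) (a j) := by
  have := hA.fintype
  have hFA : F ⊆ A := (h 0).1.2.1.1
  choose n hn hna using fun i => exists_coeff_of_mem_NSemi subset_rfl (h i).1.1
  obtain ⟨φ, hφ⟩ := (wellQuasiOrdered_le (α := A → ℕ)).exists_monotone_subseq n
  have hmono : ∀ v : A, Monotone fun i => n (φ i) v := fun v i j hij => hφ i j hij v
  let U : Set A := {v | Filter.Tendsto (fun i => n (φ i) v) Filter.atTop Filter.atTop}
  obtain ⟨N, hN⟩ : ∃ N, ∀ v ∉ U, ∀ j ≥ N, n (φ j) v = n (φ N) v := by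
    have hev : ∀ v : A, ∀ᶠ N in Filter.atTop, v ∉ U → ∀ j ≥ N, n (φ j) v = n (φ N) v := by
      intro v
      by_cases hv : v ∈ U
      · exact Filter.Eventually.of_forall fun _ h => absurd hv h
      rcases tendsto_atTop_of_monotone (hmono v) with hU | ⟨l, hl⟩
      · exact absurd hU hv
      rw [nhds_discrete, Filter.tendsto_pure, Filter.eventually_atTop] at hl
      obtain ⟨N, hN⟩ := hl
      filter_upwards [Filter.eventually_ge_atTop N] with M hM _ j hj
      rw [hN j (le_trans hM hj), hN M hM]
    exact (Filter.eventually_all.mpr hev).exists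
  let S : Set (Fin d → ℤ) := F ∪ Subtype.val '' U
  have hcell : cell (a (φ N)) S ⊆ stdSet A E := by
    rintro _ ⟨s, hs, rfl⟩
    have hSA : S ⊆ A := Set.union_subset hFA (by rintro _ ⟨v, -, rfl⟩; exact v.2)
    refine ⟨add_mem (h _).1.1 (AddSubmonoid.closure_mono hSA hs), fun hsE => ?_⟩
    obtain ⟨m, hm, rfl⟩ := exists_coeff_of_mem_NSemi hSA hs
    obtain ⟨j, hj⟩ : ∃ j, ∀ v : A, v ∈ U → n (φ N) v + m v ≤ n (φ j) v := by
      refine (Filter.eventually_all.mpr fun v => ?_ :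
        ∀ᶠ j in Filter.atTop, ∀ v : A, v ∈ U → n (φ N) v + m v ≤ n (φ j) v).exists
      by_cases hv : v ∈ U
      · filter_upwards [Filter.Tendsto.eventually_ge_atTop hv (n (φ N) v + m v)] with j hj _
        exact hj
      · exact Filter.Eventually.of_forall fun _ h => absurd h hv
    classical
    let f : A → ℕ := fun v => if (v : Fin d → ℤ) ∈ F then m v else 0
    let M := max j N
    have hle : ∀ v, n (φ N) v + m v ≤ n (φ M) v + f v := by
      intro v
      have h1 : n (φ N) v ≤ n (φ M) v := hmono v (le_max_right _ _)
      have h2 : n (φ j) v ≤ n (φ M) v := hmono v (le_max_left _ _)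
      by_cases hvF : (v : Fin d → ℤ) ∈ F
      · simp only [f, if_pos hvF]; omega
      by_cases hvU : v ∈ U
      · have := hj v hvU; omega
      · have : m v = 0 := hm v (by simp [S, hvF, hvU])
        omega
    refine ((h (φ M)).1.2.2 ⟨∑ v, f v • (v : Fin d → ℤ),
      sum_mem_NSemi f fun v hv => if_neg hv, rfl⟩).2 ?_
    have hsum : a (φ M) + ∑ v, f v • (v : Fin d → ℤ) =
        a (φ N) + ∑ v, m v • (v : Fin d → ℤ) +
          ∑ v : A, (n (φ M) v + f v - (n (φ N) v + m v)) • (v : Fin d → ℤ) := by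
      rw [hna (φ M), hna (φ N)]
      simp only [← Finset.sum_add_distrib, ← add_smul]
      exact Finset.sum_congr rfl fun v _ => by rw [Nat.add_sub_cancel' (hle v)]
    rw [hsum]
    exact hE.2 _ hsE _ (sum_mem_NSemi _ fun v hv => absurd v.2 hv)
  have hSF : S ⊆ F := (h (φ N)).subset_of_cell_subset hA hE Set.subset_union_left
    (Set.union_subset hFA (by rintro _ ⟨v, -, rfl⟩; exact v.2)) hcell
  refine ⟨φ (N + 1), φ N, fun heq => by simpa using φ.injective heq, ?_⟩
  rw [Overlap, hna (φ (N + 1)), hna (φ N), ← Finset.sum_sub_distrib]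
  refine sum_mem fun v _ => ?_
  by_cases hv : v ∈ U
  · have hvF : (v : Fin d → ℤ) ∈ ZGrp F :=
      AddSubgroup.subset_closure (hSF (Or.inr ⟨v, hv, rfl⟩))
    exact sub_mem (nsmul_mem hvF _) (nsmul_mem hvF _)
  · rw [hN v hv (N + 1) (Nat.le_succ N), sub_self]
    exact zero_mem _

/-- A monomial ideal (exponent set `E`) has only finitely many overlap
classes of standard pairs: the quotient of the set of standard pairs of `E` by the
overlap equivalence relation is finite. -/
theorem finitely_many_overlap_classes {d : ℕ} (A : Set (Fin d → ℤ)) (hA : IsConfig A)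
    (E : Set (Fin d → ℤ)) (hE : IsExpSet A E) :
    Finite (Quot (fun (p q : {p : (Fin d → ℤ) × Set (Fin d → ℤ) // StdPair A E p.1 p.2}) =>
      p.1.2 = q.1.2 ∧ Overlap p.1.2 p.1.1 q.1.1)) := by
  by_contra hfin
  rw [not_finite_iff_infinite] at hfin
  have : Finite (𝒫 A) := hA.finite.finite_subsets
  obtain ⟨⟨F, hF⟩, hinf⟩ := Finite.exists_infinite_fiber fun c : Quot (fun
    (p q : {p : (Fin d → ℤ) × Set (Fin d → ℤ) // StdPair A E p.1 p.2}) =>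
      p.1.2 = q.1.2 ∧ Overlap p.1.2 p.1.1 q.1.1) => (⟨c.out.1.2, c.out.2.1.2.1.1⟩ : 𝒫 A)
  let c := @Infinite.natEmbedding _ hinf
  have hc : ∀ i, (c i).1.out.1.2 = F := fun i => congrArg Subtype.val (c i).2
  obtain ⟨i, j, hij, hov⟩ := exists_overlap_of_forall_stdPair hA.finite hE
    (fun i => (c i).1.out.1.1) (F := F) fun i => by
      have := (c i).1.out.2
      rwa [hc i] at this
  refine hij (c.injective (Subtype.ext ?_))
  rw [← Quot.out_eq (c i).1, ← Quot.out_eq (c j).1]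
  exact Quot.sound ⟨(hc i).trans (hc j).symm, by rw [hc i]; exact hov⟩

end StdPairsPaper
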